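/- Let k be an algebraically closed field of characteristic zero. Then gdim L_{3,4}(2,2,2,2,2,2,2,2,2) = 1: for any nine points of ℙ^3(k) the space of quartic forms having multiplicity at least 2 at all nine points has dimension at least 1, and for nine points in general position this space is exactly 1-dimensional (its only members are the scalar multiples of the square of the quadric through the nine points). -/

import Mathlib

open MvPolynomial Finset

noncomputable section

/-- The homogeneous vanishing ideal of the point of `ℙ^{N-1}` represented by the
vector `v`: the ideal generated by the linear forms vanishing at `v`. -/
def pointIdeal (k : Type) [Field k] (N : ℕ) (v : Fin N → k) :
    Ideal (MvPolynomial (Fin N) k) :=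
  Ideal.span {P | P ∈ homogeneousSubmodule (Fin N) k 1 ∧ eval v P = 0}

/-- The homogeneous vanishing ideal `(x_j : j ≠ i)` of the `i`-th coordinate point. -/
def coordIdeal (k : Type) [Field k] (N : ℕ) (i : ℕ) :
    Ideal (MvPolynomial (Fin N) k) :=
  Ideal.span {P | ∃ j : Fin N, (j : ℕ) ≠ i ∧ P = X j}

/-- The linear system `L_{n,d}(m_1,…,m_s; p_1,…,p_s)` of degree-`d` forms in `n+1`
variables with multiplicity at least `m i` at the point `p i`, for `i < s`. -/
def linSys (k : Type) [Field k] (n d s : ℕ) (m : ℕ → ℕ)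
    (p : ℕ → (Fin (n + 1) → k)) : Submodule k (MvPolynomial (Fin (n + 1)) k) :=
  (homogeneousSubmodule (Fin (n + 1)) k d) ⊓
    ⨅ i ∈ Finset.range s,
      Submodule.restrictScalars k (pointIdeal k (n + 1) (p i) ^ (m i))

/-- The generic dimension of `L_{n,d}(m_1,…,m_s)`: the minimum over all `s`-tuples of
points of `ℙ^n(k)` of the dimension of the corresponding linear system. -/
def gdim (k : Type) [Field k] (n d s : ℕ) (m : ℕ → ℕ) : ℕ :=
  sInf {N | ∃ p : ℕ → (Fin (n + 1) → k),
    (∀ i < s, p i ≠ 0) ∧ N = Module.finrank k ↥(linSys k n d s m p)}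

/-- `k_I = max(Σ_{i∈I} m_i − (|I|−1)d, 0)`. -/
def kIdx (d : ℕ) (m : ℕ → ℕ) (I : Finset ℕ) : ℤ :=
  max ((∑ i ∈ I, (m i : ℤ)) - ((I.card : ℤ) - 1) * d) 0

/-- `binom(a, n)`, understood to be `0` whenever `a < n` (in particular for negative `a`). -/
def binomZ (a : ℤ) (n : ℕ) : ℤ :=
  if a < (n : ℤ) then 0 else ((a.toNat).choose n : ℤ)

/-- The (affine) linear virtual dimension
`ℓ(n,d;m_1,…,m_s) = Σ_{I ⊆ {1,…,s}} (−1)^{|I|} binom(n + k_I − |I|, n)`. -/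
def ldim (n d s : ℕ) (m : ℕ → ℕ) : ℤ :=
  ∑ I ∈ (Finset.range s).powerset,
    (-1) ^ I.card * binomZ ((n : ℤ) + kIdx d m I - (I.card : ℤ)) n

/-- A form vanishing at `v ≠ 0` lies in the ideal of the point `v`. -/
theorem mem_pointIdeal {k : Type} [Field k] {N d : ℕ} {v : Fin N → k} (hv : v ≠ 0)
    {P : MvPolynomial (Fin N) k} (hP : P.IsHomogeneous d) (h : eval v P = 0) :
    P ∈ pointIdeal k N v := by
  obtain ⟨i, hi⟩ := Function.ne_iff.mp hv
  have hX (j : Fin N) : Ideal.Quotient.mk (pointIdeal k N v) (X j) =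
      Ideal.Quotient.mk (pointIdeal k N v) (C (v j * (v i)⁻¹) * X i) := by
    rw [Ideal.Quotient.eq]
    refine Ideal.subset_span ⟨?_, ?_⟩
    · exact (isHomogeneous_X k j).sub ((isHomogeneous_X k i).C_mul _)
    · simp only [map_sub, map_mul, eval_X, eval_C]
      field_simp [show v i ≠ 0 from hi]
      simp
  rw [← Ideal.Quotient.eq_zero_iff_mem]
  have key : Ideal.Quotient.mk (pointIdeal k N v) P =
      Ideal.Quotient.mk (pointIdeal k N v) (C (eval v P) * (C (v i)⁻¹ * X i) ^ d) := by
    conv_lhs => rw [P.as_sum]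
    rw [eval_eq, map_sum, map_sum, sum_mul, map_sum]
    refine Finset.sum_congr rfl fun m hm => ?_
    have hd : ∑ i, m i = d := by
      rw [← Finsupp.degree_eq_sum]
      by_contra hne
      exact (mem_support_iff.mp hm) (hP.coeff_eq_zero hne)
    rw [monomial_eq, Finsupp.prod_fintype _ _ (by simp), ← hd, ← Finset.prod_pow_eq_pow_sum]
    simp only [map_mul, map_prod, map_pow]
    rw [Finset.prod_congr rfl fun j (_ : j ∈ univ) => congrArg (· ^ m j) (hX j)]
    simp only [map_mul]
    rw [Finset.prod_subset (Finset.subset_univ m.support), mul_assoc, ← Finset.prod_mul_distrib]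
    · congr 1
      refine Finset.prod_congr rfl fun j _ => ?_
      ring
    · intro j _ hj
      simp [Finsupp.notMem_support_iff.mp hj]
  rw [key, h]
  simp

/-- A polynomial of multiplicity at least `2` at `v` has all partial derivatives vanishing at `v`. -/
theorem eval_pderiv_of_mem_pointIdeal_sq {k : Type} [Field k] {N : ℕ} {v : Fin N → k}
    {P : MvPolynomial (Fin N) k} (hP : P ∈ pointIdeal k N v ^ 2) (j : Fin N) :
    eval v (pderiv j P) = 0 := by
  have hle : pointIdeal k N v ≤ RingHom.ker (eval v) :=
    Ideal.span_le.mpr fun P hP => hP.2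
  rw [pow_two] at hP
  induction hP using Submodule.mul_induction_on' with
  | mem_mul_mem a ha b hb =>
    have ha := hle ha
    have hb := hle hb
    rw [RingHom.mem_ker] at ha hb
    simp [ha, hb]
  | add a _ b _ ha hb => simp [ha, hb]

/-- Any nine points of `ℙ³` lie on a quadric. -/
theorem exists_quadric {k : Type} [Field k] (p : ℕ → Fin 4 → k) :
    ∃ Q : MvPolynomial (Fin 4) k, Q.IsHomogeneous 2 ∧ Q ≠ 0 ∧ ∀ i < 9, eval (p i) Q = 0 := by
  let S : Finset (Fin 4 →₀ ℕ) := Finset.finsuppAntidiag univ 2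
  have hS : S.card = 10 := by
    simp [S, Finset.card_finsuppAntidiag_nat_eq_choose, Nat.choose]
  let φ : (S → k) →ₗ[k] MvPolynomial (Fin 4) k :=
    Fintype.linearCombination k fun m : S => monomial (m : Fin 4 →₀ ℕ) (1 : k)
  let ψ : MvPolynomial (Fin 4) k →ₗ[k] (Fin 9 → k) :=
    LinearMap.pi fun i => (aeval (p i)).toLinearMap
  have hker : LinearMap.ker (ψ ∘ₗ φ) ≠ ⊥ :=
    LinearMap.ker_ne_bot_of_finrank_lt (by simp [hS])
  obtain ⟨c, hc, hc0⟩ := Submodule.exists_mem_ne_zero_of_ne_bot hker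
  have hφ : φ c = ∑ m : S, monomial (m : Fin 4 →₀ ℕ) (c m) := by
    simp [φ, Fintype.linearCombination_apply, smul_monomial]
  refine ⟨φ c, ?_, ?_, fun i hi => ?_⟩
  · rw [hφ]
    refine IsHomogeneous.sum _ _ _ fun m _ => isHomogeneous_monomial _ ?_
    rw [Finsupp.degree_eq_sum]
    exact (Finset.mem_finsuppAntidiag.mp m.2).1
  · intro h
    apply hc0
    ext m
    rw [hφ] at h
    have := congrArg (coeff (m : Fin 4 →₀ ℕ)) h
    simpa [coeff_sum, coeff_monomial, Subtype.coe_inj] using this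
  · have := congrFun (LinearMap.mem_ker.mp hc) ⟨i, hi⟩
    simpa [ψ, aeval_eq_eval] using this

theorem sum_antidiagonalTuple_four_four {M : Type*} [AddCommMonoid M] (f : (Fin 4 → ℕ) → M) :
    ∑ e ∈ Finset.Nat.antidiagonalTuple 4 4, f e =
      ∑ a ∈ range 5, ∑ b ∈ range (5 - a), ∑ c ∈ range (5 - a - b), f ![a, b, c, 4 - a - b - c] := by
  change (Multiset.map f ((List.Nat.antidiagonalTuple 4 4 : List _) : Multiset _)).sum = _
  rw [Multiset.map_coe, Multiset.sum_coe]
  simp [List.Nat.antidiagonalTuple, List.Nat.antidiagonal, List.range_succ,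
    Finset.sum_range_succ, List.flatMap_cons, Matrix.vecCons, add_assoc, Matrix.vecEmpty]

/-- The partial derivatives of a quaternary quartic form in terms of its coefficients. -/
theorem eval_pderiv_quartic {k : Type*} [Field k] {F : MvPolynomial (Fin 4) k}
    (hF : F.IsHomogeneous 4) (v : Fin 4 → k) (j : Fin 4) :
    eval v (pderiv j F) = ∑ a ∈ range 5, ∑ b ∈ range (5 - a), ∑ c ∈ range (5 - a - b),
      coeff (Finsupp.equivFunOnFinite.symm ![a, b, c, 4 - a - b - c]) F *
        ![a * (v 0 ^ (a - 1) * v 1 ^ b * v 2 ^ c * v 3 ^ (4 - a - b - c)),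
          b * (v 0 ^ a * v 1 ^ (b - 1) * v 2 ^ c * v 3 ^ (4 - a - b - c)),
          c * (v 0 ^ a * v 1 ^ b * v 2 ^ (c - 1) * v 3 ^ (4 - a - b - c)),
          (4 - a - b - c : ℕ) * (v 0 ^ a * v 1 ^ b * v 2 ^ c * v 3 ^ (4 - a - b - c - 1))] j := by
  trans ∑ e ∈ Finset.Nat.antidiagonalTuple 4 4,
      coeff (Finsupp.equivFunOnFinite.symm e) F * (e j : ℕ) *
        ∏ i, v i ^ (e i - if i = j then 1 else 0)
  · have : F = ∑ e ∈ Finset.Nat.antidiagonalTuple 4 4,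
        monomial (Finsupp.equivFunOnFinite.symm e) (coeff (Finsupp.equivFunOnFinite.symm e) F) := by
      ext m
      simp only [coeff_sum, coeff_monomial]
      rw [Finset.sum_eq_single (m : Fin 4 → ℕ)]
      · simp
      · intro b _ hb
        rw [if_neg]
        rintro rfl
        exact hb rfl
      · intro hm
        simp only [Finset.Nat.mem_antidiagonalTuple] at hm
        simp only [Finsupp.equivFunOnFinite_symm_coe, if_true]
        apply hF.coeff_eq_zero
        rwa [Finsupp.degree_eq_sum]
    conv_lhs => rw [this]
    simp only [map_sum, pderiv_monomial, eval_monomial]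
    refine Finset.sum_congr rfl fun e _ => ?_
    rw [Finsupp.prod_fintype _ _ (by simp)]
    congr 1
    refine Finset.prod_congr rfl fun i _ => ?_
    simp [Finsupp.single_apply, eq_comm]
  · rw [sum_antidiagonalTuple_four_four]
    refine sum_congr rfl fun a _ => sum_congr rfl fun b _ => sum_congr rfl fun c _ => ?_
    rw [mul_assoc, Fin.prod_univ_four]
    congr 1
    fin_cases j <;> simp

/-- Nine points of `ℙ³` that impose `34` conditions on quartics singular at all of them. -/
def ninePoints (k : Type*) [Field k] : ℕ → Fin 4 → k
  | 0 => ![1, 0, 0, 0]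
  | 1 => ![0, 1, 0, 0]
  | 2 => ![0, 0, 1, 0]
  | 3 => ![0, 0, 0, 1]
  | 4 => ![1, 1, 1, 1]
  | 5 => ![1, 0, 1, -1]
  | 6 => ![-1, 1, 0, 1]
  | 7 => ![0, 0, 1, 1]
  | _ => ![0, -1, 1, 0]

set_option maxHeartbeats 2000000 in
/-- A quartic singular at all of `ninePoints` and without `x₀² x₂²`-term is zero. -/
theorem eq_zero_of_eval_pderiv_eq_zero {k : Type*} [Field k] [CharZero k]
    {F : MvPolynomial (Fin 4) k} (hF : F.IsHomogeneous 4)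
    (h₀ : coeff (Finsupp.equivFunOnFinite.symm ![2, 0, 2, 0]) F = 0)
    (h : ∀ i < 9, ∀ j, eval (ninePoints k i) (pderiv j F) = 0) : F = 0 := by
  obtain ⟨q, hq⟩ : ∃ q : ℕ → ℕ → ℕ → ℕ → k, ∀ a b c d,
      coeff (Finsupp.equivFunOnFinite.symm ![a, b, c, d]) F = q a b c d := ⟨_, fun _ _ _ _ => rfl⟩
  suffices hz : ∀ a < 5, ∀ b < 5 - a, ∀ c < 5 - a - b, q a b c (4 - a - b - c) = 0 by
    ext m
    by_cases hm : m.degree = 4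
    · rw [Finsupp.degree_eq_sum, Fin.sum_univ_four] at hm
      have hm' : m = Finsupp.equivFunOnFinite.symm ![m 0, m 1, m 2, 4 - m 0 - m 1 - m 2] := by
        ext i
        fin_cases i <;> simp
        omega
      rw [hm', hq, hz _ (by omega) _ (by omega) _ (by omega), coeff_zero]
    · rw [hF.coeff_eq_zero hm, coeff_zero]
  simp only [eval_pderiv_quartic hF, hq] at h h₀
  clear hq hF
  simp [Fin.forall_fin_succ, sum_range_succ] at h
  have p0 := h 0 (by norm_num)
  have p1 := h 1 (by norm_num)
  have p2 := h 2 (by norm_num)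
  have p3 := h 3 (by norm_num)
  have p4 := h 4 (by norm_num)
  have p5 := h 5 (by norm_num)
  have p6 := h 6 (by norm_num)
  have p7 := h 7 (by norm_num)
  have p8 := h 8 (by norm_num)
  clear h
  simp [ninePoints] at p0 p1 p2 p3
  obtain ⟨h4000, h3100, h3010, h3001⟩ := p0
  obtain ⟨h1300, h0400, h0310, h0301⟩ := p1
  obtain ⟨h1030, h0130, h0040, h0031⟩ := p2
  obtain ⟨h1003, h0103, h0013, h0004⟩ := p3
  simp [ninePoints, h₀, h4000, h3100,
    h3010, h3001, h1300, h0400, h0310, h0301, h1030, h0130, h0040, h0031, h1003, h0103, h0013,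
    h0004] at p4 p5 p6 p7 p8
  obtain ⟨p40, p41, p42, p43⟩ := p4
  obtain ⟨p50, p51, p52, p53⟩ := p5
  obtain ⟨p60, p61, p62, p63⟩ := p6
  intro a ha b hb c hc
  interval_cases a <;> interval_cases b <;> interval_cases c <;>
    first | assumption | grind

instance (k : Type) [Field k] (n d s : ℕ) (m : ℕ → ℕ) (p : ℕ → Fin (n + 1) → k) :
    Module.Finite k (linSys k n d s m p) :=
  have := Module.Finite.iff_fg.mpr (homogeneousSubmodule_fg (Fin (n + 1)) k d)
  Submodule.finiteDimensional_of_le inf_le_left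

theorem mem_linSys {k : Type} [Field k] {n d s : ℕ} {m : ℕ → ℕ} {p : ℕ → Fin (n + 1) → k}
    {F : MvPolynomial (Fin (n + 1)) k} :
    F ∈ linSys k n d s m p ↔
      F.IsHomogeneous d ∧ ∀ i < s, F ∈ pointIdeal k (n + 1) (p i) ^ m i := by
  simp [linSys]

theorem one_le_finrank_linSys {k : Type} [Field k] (p : ℕ → Fin 4 → k) (hp : ∀ i < 9, p i ≠ 0) :
    1 ≤ Module.finrank k (linSys k 3 4 9 (fun _ => 2) p) := by
  obtain ⟨Q, hQ, hQ0, hQp⟩ := exists_quadric p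
  have hmem : Q ^ 2 ∈ linSys k 3 4 9 (fun _ => 2) p :=
    mem_linSys.mpr ⟨hQ.pow 2, fun i hi =>
      Ideal.pow_mem_pow (mem_pointIdeal (hp i hi) hQ (hQp i hi)) 2⟩
  have : Nontrivial (linSys k 3 4 9 (fun _ => 2) p) :=
    ⟨⟨⟨Q ^ 2, hmem⟩, 0, fun h => pow_ne_zero 2 hQ0 (congrArg Subtype.val h)⟩⟩
  exact Module.finrank_pos

theorem ninePoints_ne_zero (k : Type) [Field k] (i : ℕ) : ninePoints k i ≠ 0 := by
  unfold ninePoints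
  split <;> simp

theorem finrank_linSys_ninePoints_le {k : Type} [Field k] [CharZero k] :
    Module.finrank k (linSys k 3 4 9 (fun _ => 2) (ninePoints k)) ≤ 1 := by
  let φ : linSys k 3 4 9 (fun _ => 2) (ninePoints k) →ₗ[k] k :=
    lcoeff k (Finsupp.equivFunOnFinite.symm ![2, 0, 2, 0]) ∘ₗ Submodule.subtype _
  have hφ : Function.Injective φ := by
    refine (injective_iff_map_eq_zero φ).mpr fun F hF => Subtype.ext ?_
    obtain ⟨h4, hsing⟩ := mem_linSys.mp F.2
    exact eq_zero_of_eval_pderiv_eq_zero h4 hF fun i hi j =>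
      eval_pderiv_of_mem_pointIdeal_sq (hsing i hi) j
  simpa using LinearMap.finrank_le_finrank_of_injective hφ

/-- `gdim L_{3,4}(2^9) = 1`; in particular for any nine points of
`ℙ^3(k)` the space of quartics singular at all of them has dimension at least `1`,
and for nine general points the dimension is exactly `1`. -/
theorem stmt13 (k : Type) [Field k] [IsAlgClosed k] [CharZero k] :
    gdim k 3 4 9 (fun _ => 2) = 1 ∧
    ∀ p : ℕ → (Fin 4 → k), (∀ i < 9, p i ≠ 0) →
      1 ≤ Module.finrank k ↥(linSys k 3 4 9 (fun _ => 2) p) := by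
  refine ⟨le_antisymm (Nat.sInf_le ⟨ninePoints k, fun i _ => ninePoints_ne_zero k i, ?_⟩) ?_,
    one_le_finrank_linSys⟩
  · exact le_antisymm (one_le_finrank_linSys _ fun i _ => ninePoints_ne_zero k i)
      finrank_linSys_ninePoints_le
  · refine le_csInf ⟨_, ninePoints k, fun i _ => ninePoints_ne_zero k i, rfl⟩ ?_
    rintro _ ⟨p, hp, rfl⟩
    exact one_le_finrank_linSys p hp
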